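/- Let f be an expanding Lorenz map with critical point c admitting a primary n(k)-cycle O = {z_0, …, z_{n-1}} with z_0 < ⋯ < z_{n-k-1} < c < z_{n-k} < ⋯ < z_{n-1}, and assume z_{k-1} ≠ f(0) and z_k ≠ f(1). Put u = f^{n-1}(0), v = f^{n-1}(1) and J = {x ∈ [0,1] : there is no m ≥ 0 with f^i(x) ≠ c for 0 ≤ i < m and f^m(x) ∈ (u,v)} (so J is the set of points whose forward orbit never enters (u,v); membership does not depend on any value of f at c, since c ∈ (u,v)). Then J is a closed set with O ⊆ J, c ∉ J, 0 ∉ J and 1 ∉ J; in particular J is a nonempty proper subset of [0,1]. Moreover, adopting the convention f(c) = 0, J is completely invariant: f(J) = J = f^{-1}(J). -/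

import Mathlib

open Set Filter Topology Function

/-- `f` is an expanding Lorenz map on `[a,b]` with critical point `c`:
continuous and strictly increasing on `[a,c)` and `(c,b]`, with
`lim_{x→c⁻} f(x) = b`, `lim_{x→c⁺} f(x) = a`, and differentiable with
derivative uniformly greater than `1` outside a finite set. -/
structure IsExpandingLorenzOn (f : ℝ → ℝ) (c a b : ℝ) : Prop where
  a_lt_c : a < c
  c_lt_b : c < b
  mapsTo : Set.MapsTo f (Set.Icc a b) (Set.Icc a b)
  mono_left : StrictMonoOn f (Set.Ico a c)
  mono_right : StrictMonoOn f (Set.Ioc c b)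
  cont_left : ContinuousOn f (Set.Ico a c)
  cont_right : ContinuousOn f (Set.Ioc c b)
  lim_left : Filter.Tendsto f (nhdsWithin c (Set.Iio c)) (nhds b)
  lim_right : Filter.Tendsto f (nhdsWithin c (Set.Ioi c)) (nhds a)
  expanding : ∃ F : Set ℝ, F.Finite ∧ ∃ lam : ℝ, 1 < lam ∧
    ∀ x ∈ Set.Icc a b \ F, ∃ d : ℝ, HasDerivWithinAt f d (Set.Icc a b) x ∧ lam ≤ d

/-- An expanding Lorenz map on `[0,1]` with critical point `c`. -/
def IsExpandingLorenz (f : ℝ → ℝ) (c : ℝ) : Prop := IsExpandingLorenzOn f c 0 1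

/-- A primary `n(k)`-cycle `z 0 < z 1 < ⋯ < z (n-k-1) < c < z (n-k) < ⋯ < z (n-1)`
for a Lorenz map `f` with critical point `c`. -/
structure IsPrimaryCycle (f : ℝ → ℝ) (c : ℝ) (n k : ℕ) (z : ℕ → ℝ) : Prop where
  k_pos : 0 < k
  k_lt_n : k < n
  coprime : Nat.Coprime n k
  mem : ∀ i < n, z i ∈ Set.Icc (0:ℝ) 1
  mono : ∀ i j : ℕ, i < j → j < n → z i < z j
  left_of_c : ∀ i < n - k, z i < c
  right_of_c : ∀ i : ℕ, n - k ≤ i → i < n → c < z i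
  step : ∀ i < n, f (z i) = z ((i + k) % n)
  le_f0 : z (k - 1) ≤ f 0
  f1_le : f 1 ≤ z k

/-- `g` is a renormalization `(f^l, f^r)` of the Lorenz map `f` on the
renormalization interval `[u,v]`: on `[u,c)` (resp. `(c,v]`) the map `g`
is given by `f^[l]` (resp. `f^[r]`), with values given by one-sided limits
at points where some earlier iterate hits `c`, and `g` is itself an
expanding Lorenz map on `[u,v]` with critical point `c`. -/
structure IsRenormalization (f : ℝ → ℝ) (c : ℝ) (l r : ℕ) (u v : ℝ) (g : ℝ → ℝ) : Prop where
  one_lt_l : 1 < l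
  one_lt_r : 1 < r
  u_nonneg : 0 ≤ u
  u_lt_c : u < c
  c_lt_v : c < v
  v_le_one : v ≤ 1
  proper : 0 < u ∨ v < 1
  eq_left : ∀ x ∈ Set.Ico u c, (∀ i < l, f^[i] x ≠ c) → g x = f^[l] x
  eq_right : ∀ x ∈ Set.Ioc c v, (∀ i < r, f^[i] x ≠ c) → g x = f^[r] x
  lim_left_pt : ∀ x ∈ Set.Ico u c,
    Filter.Tendsto (f^[l]) (nhdsWithin x (Set.Ioi x)) (nhds (g x))
  lim_right_pt : ∀ x ∈ Set.Ioc c v,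
    Filter.Tendsto (f^[r]) (nhdsWithin x (Set.Iio x)) (nhds (g x))
  lim_c_left : Filter.Tendsto (f^[l]) (nhdsWithin c (Set.Iio c)) (nhds v)
  lim_c_right : Filter.Tendsto (f^[r]) (nhdsWithin c (Set.Ioi c)) (nhds u)
  lorenz : IsExpandingLorenzOn g c u v

/-- The forward orbit of `x` enters the set `S` with a `c`-free prefix:
there is `n ≥ 0` with `f^[i] x ≠ c` for `0 ≤ i < n` and `f^[n] x ∈ S`. -/
def CFreeEnters (f : ℝ → ℝ) (c : ℝ) (S : Set ℝ) (x : ℝ) : Prop :=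
  ∃ n : ℕ, (∀ i < n, f^[i] x ≠ c) ∧ f^[n] x ∈ S

/-- `N(U) = min {n ≥ 0 : f^[n] z = c for some z ∈ U}`. -/
noncomputable def hitTime (f : ℝ → ℝ) (c : ℝ) (U : Set ℝ) : ℕ :=
  sInf {n : ℕ | ∃ z ∈ U, f^[n] z = c}

/-- `x ∈ [0,1]` is a `c`-free periodic point of `f` of (exact) period `p`. -/
def IsCFreePeriodic (f : ℝ → ℝ) (c x : ℝ) (p : ℕ) : Prop :=
  x ∈ Set.Icc (0:ℝ) 1 ∧ f^[p] x = x ∧ (∀ i : ℕ, 0 < i → i < p → f^[i] x ≠ x) ∧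
    ∀ i < p, f^[i] x ≠ c

/-- Topological transitivity of `f` as a map of `[0,1]`. -/
def LorenzTransitive (f : ℝ → ℝ) : Prop :=
  ∀ U V : Set ℝ, IsOpen U → IsOpen V →
    (U ∩ Set.Icc 0 1).Nonempty → (V ∩ Set.Icc 0 1).Nonempty →
    ∃ n : ℕ, (f^[n] '' (U ∩ Set.Icc 0 1) ∩ (V ∩ Set.Icc 0 1)).Nonempty

/-- `f` is locally eventually onto: every nonempty (relatively) open subset of `[0,1]`
contains open intervals mapped homeomorphically onto `(0,c)` and onto `(c,1)`
by suitable iterates of `f`. -/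
def LocallyEventuallyOnto (f : ℝ → ℝ) (c : ℝ) : Prop :=
  ∀ U : Set ℝ, IsOpen U → (U ∩ Set.Icc 0 1).Nonempty →
    (∃ a b : ℝ, a < b ∧ Set.Ioo a b ⊆ U ∩ Set.Icc 0 1 ∧ ∃ n : ℕ,
      ContinuousOn (f^[n]) (Set.Ioo a b) ∧ Set.InjOn (f^[n]) (Set.Ioo a b) ∧
        f^[n] '' Set.Ioo a b = Set.Ioo 0 c) ∧
    (∃ a b : ℝ, a < b ∧ Set.Ioo a b ⊆ U ∩ Set.Icc 0 1 ∧ ∃ n : ℕ,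
      ContinuousOn (f^[n]) (Set.Ioo a b) ∧ Set.InjOn (f^[n]) (Set.Ioo a b) ∧
        f^[n] '' Set.Ioo a b = Set.Ioo c 1)

/-- The generalized backward orbit of `x`: points joined to `x` by a chain
following `f`, where at the critical point `c` the chain may continue with
either `0` or `1`. -/
def GenBackwardOrbit (f : ℝ → ℝ) (c x : ℝ) : Set ℝ :=
  {y | y ∈ Set.Icc (0:ℝ) 1 ∧ ∃ (k : ℕ) (w : ℕ → ℝ), w 0 = y ∧ w k = x ∧
    ∀ i < k, (w i ≠ c → w (i + 1) = f (w i)) ∧ (w i = c → w (i + 1) = 0 ∨ w (i + 1) = 1)}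
/-- A continuous function whose derivative exceeds `1` off a finite set strictly expands lengths. -/
theorem sub_lt_sub_of_one_lt_hasDerivAt_off_finset (f : ℝ → ℝ) (F : Finset ℝ) :
    ∀ a b : ℝ, a < b → ContinuousOn f (Icc a b) →
      (∀ x ∈ Ioo a b, x ∉ F → ∃ d, HasDerivAt f d x ∧ 1 < d) → b - a < f b - f a := by
  induction F using Finset.induction_on with
  | empty =>
    intro a b hab hcont hder
    obtain ⟨x, hx, hslope⟩ := exists_deriv_eq_slope f hab hcont fun x hx ↦
      let ⟨_, hd, _⟩ := hder x hx (by simp)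
      hd.differentiableAt.differentiableWithinAt
    obtain ⟨d, hd, hd1⟩ := hder x hx (by simp)
    rw [hd.deriv] at hslope
    have := hslope ▸ hd1
    rwa [one_lt_div (sub_pos.2 hab)] at this
  | insert p F _ ih =>
    intro a b hab hcont hder
    by_cases hp : p ∈ Ioo a b
    · have hl := ih a p hp.1 (hcont.mono (Icc_subset_Icc_right hp.2.le)) fun x hx hxF ↦
        hder x ⟨hx.1, hx.2.trans hp.2⟩ (by simp [hxF, hx.2.ne])
      have hr := ih p b hp.2 (hcont.mono (Icc_subset_Icc_left hp.1.le)) fun x hx hxF ↦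
        hder x ⟨hp.1.trans hx.1, hx.2⟩ (by simp [hxF, hx.1.ne'])
      linarith
    · refine ih a b hab hcont fun x hx hxF ↦ hder x hx ?_
      have : x ≠ p := fun h ↦ hp (h ▸ hx)
      simp [this, hxF]

namespace IsExpandingLorenz

variable {f : ℝ → ℝ} {c : ℝ}

theorem sub_lt_sub_of_continuousOn (hf : IsExpandingLorenz f c) {x y : ℝ} (hx : 0 ≤ x)
    (hxy : x < y) (hy : y ≤ 1) (hcont : ContinuousOn f (Icc x y)) : y - x < f y - f x := by
  obtain ⟨F, hF, lam, hlam, hder⟩ := hf.expanding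
  refine sub_lt_sub_of_one_lt_hasDerivAt_off_finset f hF.toFinset x y hxy hcont fun t ht htF ↦ ?_
  have ht0 : 0 < t := hx.trans_lt ht.1
  have ht1 : t < 1 := ht.2.trans_le hy
  obtain ⟨d, hd, hlamd⟩ := hder t ⟨⟨ht0.le, ht1.le⟩, by simpa using htF⟩
  exact ⟨d, hd.hasDerivAt (Icc_mem_nhds ht0 ht1), hlam.trans_le hlamd⟩

theorem sub_lt_sub_left (hf : IsExpandingLorenz f c) {x y : ℝ} (hx : 0 ≤ x) (hxy : x < y)
    (hy : y < c) : y - x < f y - f x :=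
  hf.sub_lt_sub_of_continuousOn hx hxy (hy.trans hf.c_lt_b).le
    (hf.cont_left.mono fun _ ht ↦ ⟨hx.trans ht.1, ht.2.trans_lt hy⟩)

theorem sub_lt_sub_right (hf : IsExpandingLorenz f c) {x y : ℝ} (hx : c < x) (hxy : x < y)
    (hy : y ≤ 1) : y - x < f y - f x :=
  hf.sub_lt_sub_of_continuousOn (hf.a_lt_c.trans hx).le hxy hy
    (hf.cont_right.mono fun _ ht ↦ ⟨hx.trans_le ht.1, ht.2.trans hy⟩)

theorem pos_of_lt (hf : IsExpandingLorenz f c) {x : ℝ} (hx : c < x) (hx1 : x ≤ 1) : 0 < f x := by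
  have h0 := hf.a_lt_c
  obtain ⟨y, hcy, hyx⟩ := exists_between hx
  have := hf.sub_lt_sub_right hcy hyx hx1
  have := (hf.mapsTo (show y ∈ Icc 0 1 by constructor <;> linarith)).1
  linarith

theorem lt_one_of_lt (hf : IsExpandingLorenz f c) {x : ℝ} (hx0 : 0 ≤ x) (hx : x < c) :
    f x < 1 := by
  have h1 := hf.c_lt_b
  obtain ⟨y, hxy, hyc⟩ := exists_between hx
  have := hf.sub_lt_sub_left hx0 hxy hyc
  have := (hf.mapsTo (show y ∈ Icc 0 1 by constructor <;> linarith)).2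
  linarith

theorem sub_le_apply (hf : IsExpandingLorenz f c) {x : ℝ} (hx : c < x) (hx1 : x ≤ 1) :
    x - c ≤ f x := by
  by_contra! h
  have h0 := hf.a_lt_c
  have hpos := hf.pos_of_lt hx hx1
  have := hf.sub_lt_sub_right (x := x - f x) (by linarith) (by linarith) hx1
  have := (hf.mapsTo (show x - f x ∈ Icc 0 1 by constructor <;> linarith)).1
  linarith

theorem sub_le_one_sub_apply (hf : IsExpandingLorenz f c) {x : ℝ} (hx0 : 0 ≤ x) (hx : x < c) :
    c - x ≤ 1 - f x := by
  by_contra! h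
  have h1 := hf.c_lt_b
  have hlt := hf.lt_one_of_lt hx0 hx
  have := hf.sub_lt_sub_left (y := x + (1 - f x)) hx0 (by linarith) (by linarith)
  have := (hf.mapsTo (show x + (1 - f x) ∈ Icc 0 1 by constructor <;> linarith)).2
  linarith

theorem exists_right_eq (hf : IsExpandingLorenz f c) {y : ℝ} (hy : 0 < y) (hy1 : y ≤ f 1) :
    ∃ x ∈ Icc (0 : ℝ) 1, f x = y := by
  have h0 := hf.a_lt_c
  obtain ⟨t, hty, htc, ht1⟩ := ((hf.lim_right.eventually_lt_const hy).and
    (Ioo_mem_nhdsGT hf.c_lt_b)).exists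
  obtain ⟨x, hx, hxy⟩ := intermediate_value_Icc ht1.le
    (hf.cont_right.mono fun s hs ↦ ⟨htc.trans_le hs.1, hs.2⟩) ⟨hty.le, hy1⟩
  exact ⟨x, ⟨by linarith [hx.1], hx.2⟩, hxy⟩

theorem exists_left_eq (hf : IsExpandingLorenz f c) {y : ℝ} (hy : y < 1) (hy0 : f 0 ≤ y) :
    ∃ x ∈ Icc (0 : ℝ) 1, f x = y := by
  have h1 := hf.c_lt_b
  obtain ⟨t, hty, ht0, htc⟩ := ((hf.lim_left.eventually_const_lt hy).and
    (Ioo_mem_nhdsLT hf.a_lt_c)).exists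
  obtain ⟨x, hx, hxy⟩ := intermediate_value_Icc ht0.le
    (hf.cont_left.mono fun s hs ↦ ⟨hs.1, hs.2.trans_lt htc⟩) ⟨hy0, hty.le⟩
  exact ⟨x, ⟨hx.1, by linarith [hx.2]⟩, hxy⟩

theorem iterate_mem (hf : IsExpandingLorenz f c) {x : ℝ} (hx : x ∈ Icc (0 : ℝ) 1) (m : ℕ) :
    f^[m] x ∈ Icc (0 : ℝ) 1 :=
  hf.mapsTo.iterate m hx

theorem continuousWithinAt (hf : IsExpandingLorenz f c) {x : ℝ} (hx : x ∈ Icc (0 : ℝ) 1)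
    (hxc : x ≠ c) : ContinuousWithinAt f (Icc 0 1) x := by
  rcases hxc.lt_or_gt with h | h
  · refine (hf.cont_left x ⟨hx.1, h⟩).mono_of_mem_nhdsWithin ?_
    filter_upwards [self_mem_nhdsWithin, mem_nhdsWithin_of_mem_nhds (Iio_mem_nhds h)]
      with t ht htc using ⟨ht.1, htc⟩
  · refine (hf.cont_right x ⟨h, hx.2⟩).mono_of_mem_nhdsWithin ?_
    filter_upwards [self_mem_nhdsWithin, mem_nhdsWithin_of_mem_nhds (Ioi_mem_nhds h)]
      with t ht htc using ⟨htc, ht.2⟩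

theorem continuousWithinAt_iterate (hf : IsExpandingLorenz f c) {x : ℝ}
    (hx : x ∈ Icc (0 : ℝ) 1) (m : ℕ) (hfree : ∀ i < m, f^[i] x ≠ c) :
    ContinuousWithinAt f^[m] (Icc 0 1) x := by
  induction m with
  | zero => exact continuousWithinAt_id
  | succ m ih =>
    rw [iterate_succ']
    exact (hf.continuousWithinAt (hf.iterate_mem hx m) (hfree m m.lt_succ_self)).comp
      (ih fun i hi ↦ hfree i (hi.trans m.lt_succ_self)) (hf.mapsTo.iterate m)

/-- The points of `[0,1]` whose orbit avoids an open set containing `c` form a closed set. -/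
theorem isClosed_setOf_avoid (hf : IsExpandingLorenz f c) {U : Set ℝ} (hU : IsOpen U)
    (hcU : c ∈ U) :
    IsClosed {x ∈ Icc (0 : ℝ) 1 | ∀ m : ℕ, (∀ i < m, f^[i] x ≠ c) → f^[m] x ∉ U} := by
  refine isClosed_of_closure_subset fun x hx ↦ ?_
  have hx1 : x ∈ Icc (0 : ℝ) 1 := isClosed_Icc.closure_subset_iff.2 (fun _ h ↦ h.1) hx
  refine ⟨hx1, fun m hm hmU ↦ ?_⟩
  obtain ⟨y, hyU, hy, hyavoid⟩ := mem_closure_iff_nhdsWithin_neBot.1 hx |>.nonempty_of_mem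
    (inter_mem (nhdsWithin_mono x (fun y hy ↦ hy.1)
      (hf.continuousWithinAt_iterate hx1 m hm (hU.mem_nhds hmU))) self_mem_nhdsWithin)
  have hfree : ∀ i, f^[i] y ≠ c := by
    intro i
    induction i using Nat.strong_induction_on with
    | _ i ih => exact fun h ↦ hyavoid i ih (h ▸ hcU)
  exact hyavoid m (fun i _ ↦ hfree i) hyU

end IsExpandingLorenz

namespace IsPrimaryCycle

variable {f : ℝ → ℝ} {c : ℝ} {n k : ℕ} {z : ℕ → ℝ}

theorem two_le (hz : IsPrimaryCycle f c n k z) : 2 ≤ n := by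
  have := hz.k_pos
  have := hz.k_lt_n
  lia

theorem step_left (hz : IsPrimaryCycle f c n k z) {i : ℕ} (hi : i < n - k) :
    f (z i) = z (i + k) := by
  rw [hz.step i (by lia), Nat.mod_eq_of_lt (by lia)]

theorem step_right (hz : IsPrimaryCycle f c n k z) {i : ℕ} (hi : n - k ≤ i) (hin : i < n) :
    f (z i) = z (i + k - n) := by
  have := hz.k_lt_n
  rw [hz.step i hin, Nat.mod_eq_sub_mod (by lia), Nat.mod_eq_of_lt (by lia)]

theorem le_of_le (hz : IsPrimaryCycle f c n k z) {i j : ℕ} (hij : i ≤ j) (hj : j < n) :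
    z i ≤ z j := by
  rcases hij.eq_or_lt with rfl | h
  · exact le_rfl
  · exact (hz.mono i j h hj).le

theorem iterate_cycle (hz : IsPrimaryCycle f c n k z) {j : ℕ} (hj : j < n) (i : ℕ) :
    f^[i] (z j) = z ((j + i * k) % n) := by
  have := hz.two_le
  induction i with
  | zero => simp [Nat.mod_eq_of_lt hj]
  | succ i ih =>
    rw [iterate_succ_apply', ih, hz.step _ (Nat.mod_lt _ (by lia)), Nat.mod_add_mod]
    congr 2
    ring

/-- No point of the cycle lies strictly between `z (n - k - 1)` and `z (n - k)`. -/
theorem iterate_cycle_notMem (hz : IsPrimaryCycle f c n k z) {j : ℕ} (hj : j < n) (i : ℕ) :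
    f^[i] (z j) ∉ Ioo (z (n - k - 1)) (z (n - k)) := by
  have hn := hz.two_le
  have hk := hz.k_lt_n
  rw [hz.iterate_cycle hj]
  have hlt := Nat.mod_lt (j + i * k) (show 0 < n by lia)
  generalize (j + i * k) % n = q at hlt
  rintro ⟨h1, h2⟩
  by_cases hq : q ≤ n - k - 1
  · exact (hz.le_of_le hq (by have := hz.k_pos; lia)).not_gt h1
  · exact (hz.le_of_le (show n - k ≤ q by lia) hlt).not_gt h2

theorem last_index (hz : IsPrimaryCycle f c n k z) : (n - 2 + 1) * k % n = n - k := by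
  obtain ⟨m, rfl⟩ := Nat.exists_eq_add_of_le' hz.two_le
  obtain ⟨l, rfl⟩ := Nat.exists_eq_add_of_le' (show 1 ≤ k from hz.k_pos)
  have hlt := hz.k_lt_n
  obtain ⟨d, hd⟩ := Nat.exists_eq_add_of_lt hlt
  have : (m + 2 - 2 + 1) * (l + 1) = (m + 2) * l + (d + 1) := by
    simp only [Nat.add_sub_cancel]
    have : m + 1 = l + d + 1 := by lia
    have h2 : m = l + d := by lia
    subst h2
    ring
  rw [this, Nat.mul_add_mod, Nat.mod_eq_of_lt (by lia)]
  lia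

theorem iterate_upper (hz : IsPrimaryCycle f c n k z) : f^[n - 2] (z k) = z (n - k) := by
  rw [hz.iterate_cycle hz.k_lt_n, ← hz.last_index]
  congr 2
  ring

theorem iterate_lower (hz : IsPrimaryCycle f c n k z) :
    f^[n - 2] (z (k - 1)) = z (n - k - 1) := by
  have hk := hz.k_pos
  have hkn := hz.k_lt_n
  rw [hz.iterate_cycle (by lia)]
  congr 1
  have h := Nat.div_add_mod ((n - 2 + 1) * k) n
  rw [hz.last_index] at h
  have : k - 1 + (n - 2) * k = n * ((n - 2 + 1) * k / n) + (n - k - 1) := by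
    rw [Nat.add_mul] at h ⊢
    lia
  rw [this, Nat.mul_add_mod, Nat.mod_eq_of_lt (by lia)]

theorem index_pos (hz : IsPrimaryCycle f c n k z) {i : ℕ} (hi : i ≤ n - 2) :
    0 < (i + 1) * k % n := by
  have hn := hz.two_le
  refine Nat.pos_of_ne_zero fun h ↦ ?_
  have := Nat.le_of_dvd (by lia) (hz.coprime.dvd_of_dvd_mul_right (Nat.dvd_of_mod_eq_zero h))
  lia

theorem index_ne (hz : IsPrimaryCycle f c n k z) {i : ℕ} (hi : i < n - 2) :
    (i + 1) * k % n ≠ n - k := by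
  intro h
  have hk := hz.k_lt_n
  have hpos := hz.index_pos (i := i + 1) (by lia)
  rw [Nat.add_mul (i + 1), one_mul, ← Nat.mod_add_mod, h, Nat.sub_add_cancel hk.le,
    Nat.mod_self] at hpos
  exact hpos.false

/-- Iterates of the gap `[z (k - 1), z k]` follow the gaps of the cycle and are not contracted. -/
theorem iterate_gap (hz : IsPrimaryCycle f c n k z) (hf : IsExpandingLorenz f c) {x y : ℝ}
    (hx : z (k - 1) ≤ x) (hxy : x < y) (hy : y ≤ z k) (i : ℕ) (hi : i ≤ n - 2) :
    z ((i + 1) * k % n - 1) ≤ f^[i] x ∧ f^[i] y ≤ z ((i + 1) * k % n) ∧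
      y - x ≤ f^[i] y - f^[i] x := by
  have hn := hz.two_le
  have hk := hz.k_pos
  have hkn := hz.k_lt_n
  induction i with
  | zero => simpa [Nat.mod_eq_of_lt hkn] using ⟨hx, hy⟩
  | succ i ih =>
    obtain ⟨h1, h2, h3⟩ := ih (by lia)
    have hne := hz.index_ne (i := i) (by lia)
    have hpos := hz.index_pos (i := i) (by lia)
    have hlt := Nat.mod_lt ((i + 1) * k) (show 0 < n by lia)
    have hnext : (i + 1 + 1) * k % n = ((i + 1) * k % n + k) % n := by
      rw [Nat.add_mul (i + 1), one_mul, Nat.mod_add_mod]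
    rw [hnext, iterate_succ_apply', iterate_succ_apply']
    generalize (i + 1) * k % n = q at *
    generalize f^[i] x = X at *
    generalize f^[i] y = Y at *
    have hXY : X < Y := by linarith
    have hq0 := (hz.mem (q - 1) (by lia)).1
    have hq1 := (hz.mem q hlt).2
    rcases hne.lt_or_gt with h | h
    · have hqc := hz.left_of_c q h
      have hexp := hf.sub_lt_sub_left (by linarith) hXY (by linarith)
      have ha := hf.mono_left.monotoneOn ⟨hq0, by linarith⟩ ⟨by linarith, by linarith⟩ h1
      have hb := hf.mono_left.monotoneOn ⟨by linarith, by linarith⟩ ⟨by linarith, hqc⟩ h2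
      rw [hz.step_left (by lia)] at ha hb
      rw [Nat.mod_eq_of_lt (by lia), show q + k - 1 = q - 1 + k by lia]
      exact ⟨ha, hb, by linarith⟩
    · have hqc := hz.right_of_c (q - 1) (by lia) (by lia)
      have hexp := hf.sub_lt_sub_right (by linarith) hXY (by linarith)
      have ha := hf.mono_right.monotoneOn ⟨hqc, by linarith⟩ ⟨by linarith, by linarith⟩ h1
      have hb := hf.mono_right.monotoneOn ⟨by linarith, by linarith⟩ ⟨by linarith, hq1⟩ h2
      rw [hz.step_right (by lia) (by lia)] at ha hb
      rw [Nat.mod_eq_sub_mod (by lia), Nat.mod_eq_of_lt (by lia),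
        show q + k - n - 1 = q - 1 + k - n by lia]
      exact ⟨ha, hb, by linarith⟩

theorem sub_le_iterate_sub (hz : IsPrimaryCycle f c n k z) (hf : IsExpandingLorenz f c)
    {x y : ℝ} (hx : z (k - 1) ≤ x) (hxy : x < y) (hy : y ≤ z k) :
    y - x ≤ f^[n - 2] y - f^[n - 2] x :=
  (hz.iterate_gap hf hx hxy hy _ le_rfl).2.2

theorem iterate_gap_ne (hz : IsPrimaryCycle f c n k z) (hf : IsExpandingLorenz f c)
    {x : ℝ} (hx : z (k - 1) < x) (hxk : x < z k) {i : ℕ} (hi : i < n - 2) : f^[i] x ≠ c := by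
  have hlower := (hz.iterate_gap hf hx.le hxk le_rfl i hi.le).1
  have hupper := (hz.iterate_gap hf le_rfl hx hxk.le i hi.le).2.1
  have hlt := Nat.mod_lt ((i + 1) * k) (show 0 < n by lia)
  have hpos := hz.index_pos hi.le
  rcases (hz.index_ne hi).lt_or_gt with h | h
  · have := hz.left_of_c _ h
    exact (hupper.trans_lt this).ne
  · have := hz.right_of_c ((i + 1) * k % n - 1) (by lia) (by lia)
    exact (this.trans_le hlower).ne'

theorem apply_upper (hz : IsPrimaryCycle f c n k z) : f (z (n - k)) = z 0 := by
  have hk := hz.k_pos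
  have hkn := hz.k_lt_n
  rw [hz.step_right le_rfl (by lia), show n - k + k - n = 0 by lia]

theorem apply_lower (hz : IsPrimaryCycle f c n k z) : f (z (n - k - 1)) = z (n - 1) := by
  have hk := hz.k_pos
  have hkn := hz.k_lt_n
  rw [hz.step_left (by lia), show n - k - 1 + k = n - 1 by lia]

theorem apply_first (hz : IsPrimaryCycle f c n k z) : f (z 0) = z k := by
  have hkn := hz.k_lt_n
  rw [hz.step_left (by lia), zero_add]

theorem apply_last (hz : IsPrimaryCycle f c n k z) : f (z (n - 1)) = z (k - 1) := by
  have hk := hz.k_pos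
  have hkn := hz.k_lt_n
  rw [hz.step_right (by lia) (by lia), show n - 1 + k - n = k - 1 by lia]

theorem lower_lt_c (hz : IsPrimaryCycle f c n k z) : z (n - k - 1) < c :=
  hz.left_of_c _ (by have := hz.k_lt_n; lia)

theorem c_lt_upper (hz : IsPrimaryCycle f c n k z) : c < z (n - k) :=
  hz.right_of_c _ le_rfl (by have := hz.k_lt_n; have := hz.k_pos; lia)

theorem upper_le_one (hz : IsPrimaryCycle f c n k z) : z (n - k) ≤ 1 :=
  (hz.mem _ (by have := hz.k_lt_n; have := hz.k_pos; lia)).2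

theorem lower_nonneg (hz : IsPrimaryCycle f c n k z) : 0 ≤ z (n - k - 1) :=
  (hz.mem _ (by have := hz.k_lt_n; have := hz.k_pos; lia)).1

theorem first_lt_c (hz : IsPrimaryCycle f c n k z) : z 0 < c :=
  hz.left_of_c _ (by have := hz.k_lt_n; lia)

theorem c_lt_last (hz : IsPrimaryCycle f c n k z) : c < z (n - 1) :=
  hz.right_of_c _ (by have := hz.k_pos; lia) (by have := hz.k_lt_n; lia)

theorem first_pos (hz : IsPrimaryCycle f c n k z) (hf : IsExpandingLorenz f c) : 0 < z 0 := by
  rw [← hz.apply_upper]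
  exact hf.pos_of_lt hz.c_lt_upper hz.upper_le_one

theorem last_lt_one (hz : IsPrimaryCycle f c n k z) (hf : IsExpandingLorenz f c) :
    z (n - 1) < 1 := by
  rw [← hz.apply_lower]
  exact hf.lt_one_of_lt hz.lower_nonneg hz.lower_lt_c

theorem sub_first_lt (hz : IsPrimaryCycle f c n k z) (hf : IsExpandingLorenz f c) {x : ℝ}
    (hx : 0 ≤ x) (hxz : x < z 0) : z 0 - x < z k - f x := by
  rw [← hz.apply_first]
  exact hf.sub_lt_sub_left hx hxz hz.first_lt_c

theorem sub_last_lt (hz : IsPrimaryCycle f c n k z) (hf : IsExpandingLorenz f c) {x : ℝ}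
    (hxz : z (n - 1) < x) (hx : x ≤ 1) : x - z (n - 1) < f x - z (k - 1) := by
  rw [← hz.apply_last]
  exact hf.sub_lt_sub_right hz.c_lt_last hxz hx

theorem apply_zero_lt (hz : IsPrimaryCycle f c n k z) (hf : IsExpandingLorenz f c) :
    f 0 < z k := by
  linarith [hz.sub_first_lt hf le_rfl (hz.first_pos hf), hz.first_pos hf]

theorem lt_apply_one (hz : IsPrimaryCycle f c n k z) (hf : IsExpandingLorenz f c) :
    z (k - 1) < f 1 := by
  linarith [hz.sub_last_lt hf (hz.last_lt_one hf) le_rfl, hz.last_lt_one hf]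

theorem iterate_pred (hz : IsPrimaryCycle f c n k z) (x : ℝ) :
    f^[n - 1] x = f^[n - 2] (f x) := by
  have := hz.two_le
  rw [← iterate_succ_apply, show (n - 2).succ = n - 1 by lia]

theorem iterate_period (hz : IsPrimaryCycle f c n k z) (x : ℝ) :
    f^[n] x = f^[n - 2] (f (f x)) := by
  have := hz.two_le
  rw [← iterate_succ_apply, ← iterate_succ_apply, show (n - 2).succ.succ = n by lia]

theorem iterate_zero_lt_c (hz : IsPrimaryCycle f c n k z) (hf : IsExpandingLorenz f c) :
    f^[n - 1] 0 < c := by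
  have h1 := hf.sub_le_apply hz.c_lt_upper hz.upper_le_one
  have h2 := hz.sub_first_lt hf le_rfl (hz.first_pos hf)
  have h3 := hz.sub_le_iterate_sub hf hz.le_f0 (hz.apply_zero_lt hf) le_rfl
  rw [hz.apply_upper] at h1
  rw [hz.iterate_upper] at h3
  rw [hz.iterate_pred]
  linarith

theorem c_lt_iterate_one (hz : IsPrimaryCycle f c n k z) (hf : IsExpandingLorenz f c) :
    c < f^[n - 1] 1 := by
  have h1 := hf.sub_le_one_sub_apply hz.lower_nonneg hz.lower_lt_c
  have h2 := hz.sub_last_lt hf (hz.last_lt_one hf) le_rfl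
  have h3 := hz.sub_le_iterate_sub hf le_rfl (hz.lt_apply_one hf) hz.f1_le
  rw [hz.apply_lower] at h1
  rw [hz.iterate_lower] at h3
  rw [hz.iterate_pred]
  linarith

theorem lower_lt_iterate_zero (hz : IsPrimaryCycle f c n k z) (hf : IsExpandingLorenz f c)
    (h0 : z (k - 1) ≠ f 0) : z (n - k - 1) < f^[n - 1] 0 := by
  have hlt := lt_of_le_of_ne hz.le_f0 h0
  have h := hz.sub_le_iterate_sub hf le_rfl hlt (hz.apply_zero_lt hf).le
  rw [hz.iterate_lower] at h
  rw [hz.iterate_pred]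
  linarith

theorem iterate_one_lt_upper (hz : IsPrimaryCycle f c n k z) (hf : IsExpandingLorenz f c)
    (h1 : z k ≠ f 1) : f^[n - 1] 1 < z (n - k) := by
  have hlt := lt_of_le_of_ne hz.f1_le h1.symm
  have h := hz.sub_le_iterate_sub hf (hz.lt_apply_one hf).le hlt le_rfl
  rw [hz.iterate_upper] at h
  rw [hz.iterate_pred]
  linarith

theorem apply_zero_le_apply_one (hz : IsPrimaryCycle f c n k z) (hf : IsExpandingLorenz f c) :
    f 0 ≤ f 1 := by
  by_contra! h
  have h' := hz.sub_le_iterate_sub hf (hz.lt_apply_one hf).le h (hz.apply_zero_lt hf).le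
  rw [← hz.iterate_pred, ← hz.iterate_pred] at h'
  linarith [hz.iterate_zero_lt_c hf, hz.c_lt_iterate_one hf]

theorem iterate_ne_of_two_steps (hz : IsPrimaryCycle f c n k z) (hf : IsExpandingLorenz f c)
    {x : ℝ} (hx : x ≠ c) (hfx : f x ≠ c) (hl : z (k - 1) < f (f x)) (hu : f (f x) < z k) :
    ∀ i < n, f^[i] x ≠ c
  | 0, _ => hx
  | 1, _ => hfx
  | i + 2, hi => by
    rw [iterate_succ_apply, iterate_succ_apply]
    exact hz.iterate_gap_ne hf hl hu (by lia)

theorem iterate_ne_of_one_step (hz : IsPrimaryCycle f c n k z) (hf : IsExpandingLorenz f c)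
    {x : ℝ} (hx : x ≠ c) (hl : z (k - 1) < f x) (hu : f x < z k) :
    ∀ i < n - 1, f^[i] x ≠ c
  | 0, _ => hx
  | i + 1, hi => by
    rw [iterate_succ_apply]
    exact hz.iterate_gap_ne hf hl hu (by lia)

/-- The first return to the central gap on the right of `c`. -/
theorem return_right (hz : IsPrimaryCycle f c n k z) (hf : IsExpandingLorenz f c) {x : ℝ}
    (hx : c < x) (hxz : x < z (n - k)) :
    (∀ i < n, f^[i] x ≠ c) ∧ f^[n - 1] 0 < f^[n] x ∧ f^[n] x < x := by
  have hpos := hf.pos_of_lt hx (hxz.le.trans hz.upper_le_one)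
  have e1 := hf.sub_lt_sub_right hx hxz hz.upper_le_one
  rw [hz.apply_upper] at e1
  have hfz : f x < z 0 := by linarith
  have hc := hz.first_lt_c
  have e2 := hz.sub_first_lt hf hpos.le hfz
  have e0 := hf.sub_lt_sub_left le_rfl hpos (hfz.trans hc)
  have hle := hz.le_f0
  have e3 := hz.sub_le_iterate_sub hf hle (show f 0 < f (f x) by linarith) (by linarith)
  have e4 := hz.sub_le_iterate_sub hf (by linarith) (show f (f x) < z k by linarith) le_rfl
  rw [hz.iterate_upper] at e4
  refine ⟨hz.iterate_ne_of_two_steps hf hx.ne' (hfz.trans hc).ne (by linarith) (by linarith), ?_⟩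
  rw [hz.iterate_pred, hz.iterate_period]
  constructor <;> linarith

/-- The first return to the central gap on the left of `c`. -/
theorem return_left (hz : IsPrimaryCycle f c n k z) (hf : IsExpandingLorenz f c) {x : ℝ}
    (hx : x < c) (hxz : z (n - k - 1) < x) :
    (∀ i < n, f^[i] x ≠ c) ∧ x < f^[n] x ∧ f^[n] x < f^[n - 1] 1 := by
  have hlt := hf.lt_one_of_lt (hz.lower_nonneg.trans hxz.le) hx
  have e1 := hf.sub_lt_sub_left hz.lower_nonneg hxz hx
  rw [hz.apply_lower] at e1
  have hfz : z (n - 1) < f x := by linarith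
  have hc := hz.c_lt_last
  have e2 := hz.sub_last_lt hf hfz hlt.le
  have e0 := hf.sub_lt_sub_right (hc.trans hfz) hlt le_rfl
  have hle := hz.f1_le
  have e3 := hz.sub_le_iterate_sub hf (by linarith) (show f (f x) < f 1 by linarith) hle
  have e4 := hz.sub_le_iterate_sub hf le_rfl (show z (k - 1) < f (f x) by linarith)
    (by linarith)
  rw [hz.iterate_lower] at e4
  refine ⟨hz.iterate_ne_of_two_steps hf hx.ne (hc.trans hfz).ne' (by linarith) (by linarith), ?_⟩
  rw [hz.iterate_pred, hz.iterate_period]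
  constructor <;> linarith

/-- Points of `[u,v]` other than `c` return to `(u,v)` after `n` steps. -/
theorem return_mem (hz : IsPrimaryCycle f c n k z) (hf : IsExpandingLorenz f c)
    (h0 : z (k - 1) ≠ f 0) (h1 : z k ≠ f 1) {x : ℝ} (hxc : x ≠ c)
    (hx : x ∈ Icc (f^[n - 1] 0) (f^[n - 1] 1)) :
    (∀ i < n, f^[i] x ≠ c) ∧ f^[n] x ∈ Ioo (f^[n - 1] 0) (f^[n - 1] 1) := by
  rcases hxc.lt_or_gt with h | h
  · obtain ⟨hfree, hl, hu⟩ :=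
      hz.return_left hf h ((hz.lower_lt_iterate_zero hf h0).trans_le hx.1)
    exact ⟨hfree, hx.1.trans_lt hl, hu⟩
  · obtain ⟨hfree, hl, hu⟩ :=
      hz.return_right hf h (hx.2.trans_lt (hz.iterate_one_lt_upper hf h1))
    exact ⟨hfree, hl, hu.trans_le hx.2⟩

end IsPrimaryCycle

theorem CFreeEnters.of_iterate {f : ℝ → ℝ} {c : ℝ} {S : Set ℝ} {x : ℝ} {m : ℕ}
    (hfree : ∀ i < m, f^[i] x ≠ c) (h : CFreeEnters f c S (f^[m] x)) : CFreeEnters f c S x := by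
  obtain ⟨l, hl, hmem⟩ := h
  refine ⟨l + m, fun i hi ↦ ?_, by rwa [iterate_add_apply]⟩
  rcases lt_or_ge i m with him | him
  · exact hfree i him
  · obtain ⟨j, rfl⟩ := Nat.exists_eq_add_of_le' him
    rw [iterate_add_apply]
    exact hl j (by lia)

/-- for a primary `n(k)`-cycle with `z (k-1) ≠ f 0` and `z k ≠ f 1`,
the set `J` of points of `[0,1]` whose forward orbit never enters `(u,v)` is a
closed, completely invariant, nonempty proper subset of `[0,1]` containing the cycle
and avoiding `c`, `0`, `1` (with the convention `f c = 0`). -/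
theorem primary_cycle_completely_invariant_set
    (f : ℝ → ℝ) (c : ℝ) (n k : ℕ) (z : ℕ → ℝ)
    (hf : IsExpandingLorenz f c) (hz : IsPrimaryCycle f c n k z)
    (h0 : z (k - 1) ≠ f 0) (h1 : z k ≠ f 1) (hc : f c = 0)
    (J : Set ℝ)
    (hJ : J = {x ∈ Set.Icc (0:ℝ) 1 | ∀ m : ℕ, (∀ i < m, f^[i] x ≠ c) →
      f^[m] x ∉ Set.Ioo (f^[n-1] (0:ℝ)) (f^[n-1] (1:ℝ))}) :
    IsClosed J ∧ (∀ i < n, z i ∈ J) ∧ c ∉ J ∧ (0:ℝ) ∉ J ∧ (1:ℝ) ∉ J ∧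
    f '' J = J ∧ Set.Icc (0:ℝ) 1 ∩ f ⁻¹' J = J := by
  set u := f^[n - 1] (0 : ℝ)
  set v := f^[n - 1] (1 : ℝ)
  have huc : u < c := hz.iterate_zero_lt_c hf
  have hcv : c < v := hz.c_lt_iterate_one hf
  have hkz : z (k - 1) < f 0 := lt_of_le_of_ne hz.le_f0 h0
  have hkz' : f 1 < z k := lt_of_le_of_ne hz.f1_le h1.symm
  have hJ' : ∀ x, x ∈ J ↔ x ∈ Icc (0 : ℝ) 1 ∧ ¬ CFreeEnters f c (Ioo u v) x := by
    intro x
    simp [hJ, CFreeEnters]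
  have hret : ∀ x ∈ Icc u v, x ≠ c → (∀ i < n, f^[i] x ≠ c) ∧ f^[n] x ∈ Ioo u v :=
    fun x hx hxc ↦ hz.return_mem hf h0 h1 hxc hx
  have hcJ : c ∉ J := fun h ↦ ((hJ' c).1 h).2 ⟨0, by simp, huc, hcv⟩
  have h0J : (0 : ℝ) ∉ J := fun h ↦ ((hJ' 0).1 h).2 <|
    CFreeEnters.of_iterate
      (hz.iterate_ne_of_one_step hf hf.a_lt_c.ne hkz (hz.apply_zero_lt hf))
      ⟨n, hret u ⟨le_rfl, (huc.trans hcv).le⟩ huc.ne⟩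
  have h1J : (1 : ℝ) ∉ J := fun h ↦ ((hJ' 1).1 h).2 <|
    CFreeEnters.of_iterate
      (hz.iterate_ne_of_one_step hf hf.c_lt_b.ne' (hz.lt_apply_one hf) hkz')
      ⟨n, hret v ⟨(huc.trans hcv).le, le_rfl⟩ hcv.ne'⟩
  have hfwd : ∀ x ∈ J, f x ∈ J := by
    intro x hx
    have hxc : x ≠ c := fun h ↦ hcJ (h ▸ hx)
    rw [hJ'] at hx ⊢
    refine ⟨hf.mapsTo hx.1, fun h ↦ hx.2 (CFreeEnters.of_iterate (m := 1) ?_ h)⟩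
    simpa using hxc
  have hbwd : ∀ x ∈ Icc (0 : ℝ) 1, f x ∈ J → x ∈ J := by
    intro x hx hfx
    have hxc : x ≠ c := by
      rintro rfl
      exact h0J (hc ▸ hfx)
    rw [hJ'] at hfx ⊢
    have hn := hz.two_le
    have hshift : ∀ m, (∀ i < m + 1, f^[i] x ≠ c) → f^[m + 1] x ∉ Ioo u v :=
      fun m hm hmem ↦ hfx.2 ⟨m, fun i hi ↦ hm (i + 1) (by lia), hmem⟩
    refine ⟨hx, ?_⟩
    rintro ⟨_ | m, hm, hmem⟩
    · obtain ⟨hfree, hmem'⟩ := hret x (Ioo_subset_Icc_self hmem) hxc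
      rw [show n = n - 1 + 1 by lia] at hfree hmem'
      exact hshift (n - 1) hfree hmem'
    · exact hshift m hm hmem
  refine ⟨?_, fun i hi ↦ ?_, hcJ, h0J, h1J, ?_, ?_⟩
  · rw [hJ]
    exact hf.isClosed_setOf_avoid isOpen_Ioo ⟨huc, hcv⟩
  · rw [hJ']
    refine ⟨hz.mem i hi, ?_⟩
    rintro ⟨m, -, hmem⟩
    exact hz.iterate_cycle_notMem hi m
      ⟨(hz.lower_lt_iterate_zero hf h0).trans hmem.1,
        hmem.2.trans (hz.iterate_one_lt_upper hf h1)⟩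
  · refine Subset.antisymm (image_subset_iff.2 hfwd) fun y hy ↦ ?_
    have hy01 := ((hJ' y).1 hy).1
    have hy0 : 0 < y := lt_of_le_of_ne hy01.1 fun h ↦ h0J (h ▸ hy)
    have hy1 : y < 1 := lt_of_le_of_ne hy01.2 fun h ↦ h1J (h ▸ hy)
    obtain ⟨x, hx, rfl⟩ : ∃ x ∈ Icc (0 : ℝ) 1, f x = y := by
      rcases le_total y (f 1) with h | h
      · exact hf.exists_right_eq hy0 h
      · exact hf.exists_left_eq hy1 ((hz.apply_zero_le_apply_one hf).trans h)
    exact ⟨x, hbwd x hx hy, rfl⟩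
  · ext x
    exact ⟨fun h ↦ hbwd x h.1 h.2, fun h ↦ ⟨((hJ' x).1 h).1, hfwd x h⟩⟩
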